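/- arXiv:solv-int/9903005 — 6 statements merged into one kernel-verified Lean document; each statement's English description precedes it below -/
import Mathlib

section
/- gl(2N,ℂ) decomposes as the direct sum of the subspaces 𝕜 and 𝕟: both 𝕜 and 𝕟 are Lie subalgebras of gl(2N,ℂ) (closed under the commutator bracket), 𝕜 ∩ 𝕟 = {0}, and 𝕜 + 𝕟 = gl(2N,ℂ), i.e. every 2N×2N complex matrix is the sum of a unique element of 𝕜 and a unique element of 𝕟. -/
open Matrix

/-- The `2N×2N` block-diagonal matrix whose diagonal `2×2` blocks all equal `[[0,1],[-1,0]]`. -/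
noncomputable def Jmat (N : ℕ) : Matrix (Fin (2 * N)) (Fin (2 * N)) ℂ :=
  Matrix.of fun i j =>
    if i.val / 2 = j.val / 2 then
      if i.val % 2 = 0 ∧ j.val % 2 = 1 then 1
      else if i.val % 2 = 1 ∧ j.val % 2 = 0 then -1
      else 0
    else 0

/-- The involution `𝒥(a) = J aᵀ J`. -/
noncomputable def Jmap (N : ℕ) (a : Matrix (Fin (2 * N)) (Fin (2 * N)) ℂ) :
    Matrix (Fin (2 * N)) (Fin (2 * N)) ℂ :=
  Jmat N * aᵀ * Jmat N

/-- Strictly block-lower-triangular part `a₋` (with respect to the `2×2` block structure). -/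
noncomputable def bLow (N : ℕ) (a : Matrix (Fin (2 * N)) (Fin (2 * N)) ℂ) :
    Matrix (Fin (2 * N)) (Fin (2 * N)) ℂ :=
  Matrix.of fun i j => if j.val / 2 < i.val / 2 then a i j else 0

/-- Block-diagonal part `a₀` (with respect to the `2×2` block structure). -/
noncomputable def bDiag (N : ℕ) (a : Matrix (Fin (2 * N)) (Fin (2 * N)) ℂ) :
    Matrix (Fin (2 * N)) (Fin (2 * N)) ℂ :=
  Matrix.of fun i j => if i.val / 2 = j.val / 2 then a i j else 0

/-- Strictly block-upper-triangular part `a₊` (with respect to the `2×2` block structure). -/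
noncomputable def bUp (N : ℕ) (a : Matrix (Fin (2 * N)) (Fin (2 * N)) ℂ) :
    Matrix (Fin (2 * N)) (Fin (2 * N)) ℂ :=
  Matrix.of fun i j => if i.val / 2 < j.val / 2 then a i j else 0

/-- `a ∈ 𝒟₀⁻`: block diagonal with each diagonal `2×2` block a scalar multiple of `I₂`. -/
def memD0minus (N : ℕ) (a : Matrix (Fin (2 * N)) (Fin (2 * N)) ℂ) : Prop :=
  (∀ i j, i ≠ j → a i j = 0) ∧
  (∀ i j : Fin (2 * N), i.val / 2 = j.val / 2 → a i i = a j j)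

/-- `a ∈ 𝕜`: block lower triangular with block-diagonal part in `𝒟₀⁻`. -/
def memK (N : ℕ) (a : Matrix (Fin (2 * N)) (Fin (2 * N)) ℂ) : Prop :=
  bUp N a = 0 ∧ memD0minus N (bDiag N a)

/-- `a ∈ 𝕟 = sp(2N)`: fixed points of `𝒥`. -/
def memN (N : ℕ) (a : Matrix (Fin (2 * N)) (Fin (2 * N)) ℂ) : Prop :=
  Jmap N a = a

/-- The projection `π_𝕜(a) = (a₋ - 𝒥(a₊)) + (1/2)(a₀ - 𝒥(a₀))`. -/
noncomputable def piK (N : ℕ) (a : Matrix (Fin (2 * N)) (Fin (2 * N)) ℂ) :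
    Matrix (Fin (2 * N)) (Fin (2 * N)) ℂ :=
  (bLow N a - Jmap N (bUp N a)) +
    (1 / 2 : ℂ) • (bDiag N a - Jmap N (bDiag N a))

/-- partner index within a block -/
def pt {N : ℕ} (i : Fin (2 * N)) : Fin (2 * N) :=
  ⟨if i.val % 2 = 0 then i.val + 1 else i.val - 1, by have := i.2; split_ifs <;> omega⟩

/-- sign -/
noncomputable def sg {N : ℕ} (i : Fin (2 * N)) : ℂ := if i.val % 2 = 0 then 1 else -1

lemma pt_div {N : ℕ} (i : Fin (2 * N)) : (pt i).val / 2 = i.val / 2 := by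
  simp only [pt]; split_ifs <;> omega

lemma pt_pt {N : ℕ} (i : Fin (2 * N)) : pt (pt i) = i := by
  apply Fin.ext; simp only [pt]; split_ifs <;> omega

lemma sg_pt {N : ℕ} (i : Fin (2 * N)) : sg (pt i) = - sg i := by
  simp only [sg, pt]; split_ifs <;> first | omega | simp

lemma sg_sq {N : ℕ} (i : Fin (2 * N)) : sg i * sg i = 1 := by
  simp only [sg]; split_ifs <;> simp

lemma block_cases {N : ℕ} (i j : Fin (2 * N)) (h : i.val / 2 = j.val / 2) :
    j = i ∨ j = pt i := by
  by_cases hh : j = i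
  · exact Or.inl hh
  · right
    have : j.val ≠ i.val := fun h => hh (Fin.ext h)
    apply Fin.ext; simp only [pt]; split_ifs <;> omega

lemma Jmat_apply {N : ℕ} (i j : Fin (2 * N)) :
    Jmat N i j = if j = pt i then sg i else 0 := by
  simp only [Jmat, Matrix.of_apply, Fin.ext_iff, pt, sg]
  split_ifs <;> first | rfl | omega

lemma Jmat_apply2 {N : ℕ} (i j : Fin (2 * N)) :
    Jmat N i j = if i = pt j then - sg j else 0 := by
  simp only [Jmat, Matrix.of_apply, Fin.ext_iff, pt, sg]
  split_ifs <;> first | rfl | omega | simp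

lemma Jmap_apply {N : ℕ} (a : Matrix (Fin (2 * N)) (Fin (2 * N)) ℂ) (i j : Fin (2 * N)) :
    Jmap N a i j = - (sg i * sg j * a (pt j) (pt i)) := by
  have h1 : ∀ k, (Jmat N * aᵀ) i k = sg i * a k (pt i) := by
    intro k
    simp [Matrix.mul_apply, Jmat_apply]
  unfold Jmap
  rw [Matrix.mul_apply]
  simp only [h1, Jmat_apply2 _ j]
  simp
  ring

lemma Jmat_sq (N : ℕ) : Jmat N * Jmat N = -1 := by
  ext i j
  simp only [Matrix.mul_apply, Jmat_apply i]
  simp only [ite_mul, zero_mul, Finset.sum_ite_eq', Finset.sum_ite_eq, Finset.mem_univ, if_true,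
    Jmat_apply, pt_pt, sg_pt, Matrix.neg_apply, Matrix.one_apply]
  by_cases h : i = j
  · simp [h, sg_sq]
  · simp [h, Ne.symm h]

lemma Jmap_mul {N : ℕ} (a b : Matrix (Fin (2 * N)) (Fin (2 * N)) ℂ) :
    Jmap N (a * b) = - (Jmap N b * Jmap N a) := by
  have : Jmap N b * Jmap N a = Jmat N * bᵀ * (Jmat N * Jmat N) * aᵀ * Jmat N := by
    simp only [Jmap, Matrix.mul_assoc]
  rw [this, Jmat_sq]
  simp [Jmap, Matrix.mul_assoc]

lemma Jmap_sub {N : ℕ} (a b : Matrix (Fin (2 * N)) (Fin (2 * N)) ℂ) :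
    Jmap N (a - b) = Jmap N a - Jmap N b := by
  simp [Jmap, Matrix.mul_sub, Matrix.sub_mul]

lemma memK_iff {N : ℕ} (a : Matrix (Fin (2 * N)) (Fin (2 * N)) ℂ) :
    memK N a ↔ (∀ i j, i.val / 2 ≤ j.val / 2 → i ≠ j → a i j = 0) ∧
      (∀ i j : Fin (2 * N), i.val / 2 = j.val / 2 → a i i = a j j) := by
  constructor
  · rintro ⟨h1, h2, h3⟩
    refine ⟨fun i j hij hne => ?_, fun i j hij => ?_⟩
    · rcases hij.lt_or_eq with h | h
      · have := congrFun (congrFun h1 i) j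
        simpa [bUp, h] using this
      · have := h2 i j hne
        simpa [bDiag, h] using this
    · simpa [bDiag] using h3 i j hij
  · rintro ⟨h1, h2⟩
    refine ⟨?_, fun i j hne => ?_, fun i j hij => ?_⟩
    · ext i j
      simp only [bUp, Matrix.of_apply, Matrix.zero_apply, ite_eq_right_iff]
      intro h
      exact h1 i j h.le (fun e => by simp [e] at h)
    · simp only [bDiag, Matrix.of_apply, ite_eq_right_iff]
      intro h
      exact h1 i j h.le hne
    · simpa [bDiag] using h2 i j hij

lemma memK_mul {N : ℕ} {a b : Matrix (Fin (2 * N)) (Fin (2 * N)) ℂ}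
    (ha : memK N a) (hb : memK N b) (i j : Fin (2 * N)) (h : i.val / 2 ≤ j.val / 2) :
    (a * b) i j = a i i * b i j := by
  rw [memK_iff] at ha hb
  rw [Matrix.mul_apply, Finset.sum_eq_single i]
  · intro k _ hk
    by_cases hik : i.val / 2 ≤ k.val / 2
    · rw [ha.1 i k hik (Ne.symm hk), zero_mul]
    · rw [hb.1 k j (by omega) (fun e => by subst e; omega), mul_zero]
  · simp

lemma memK_comm {N : ℕ} {a b : Matrix (Fin (2 * N)) (Fin (2 * N)) ℂ}
    (ha : memK N a) (hb : memK N b) : memK N (a * b - b * a) := by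
  rw [memK_iff]
  refine ⟨fun i j h hne => ?_, fun i j _ => ?_⟩
  · rw [Matrix.sub_apply, memK_mul ha hb i j h, memK_mul hb ha i j h,
      ((memK_iff a).1 ha).1 i j h hne, ((memK_iff b).1 hb).1 i j h hne]
    simp
  · simp only [Matrix.sub_apply, memK_mul ha hb _ _ le_rfl, memK_mul hb ha _ _ le_rfl]
    ring

lemma memK_sub {N : ℕ} {a b : Matrix (Fin (2 * N)) (Fin (2 * N)) ℂ}
    (ha : memK N a) (hb : memK N b) : memK N (a - b) := by
  rw [memK_iff] at *
  refine ⟨fun i j h hne => ?_, fun i j h => ?_⟩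
  · simp [ha.1 i j h hne, hb.1 i j h hne]
  · simp [ha.2 i j h, hb.2 i j h]

lemma memN_sub {N : ℕ} {a b : Matrix (Fin (2 * N)) (Fin (2 * N)) ℂ}
    (ha : memN N a) (hb : memN N b) : memN N (a - b) := by
  unfold memN at *
  rw [Jmap_sub, ha, hb]

lemma pt_ne {N : ℕ} (i : Fin (2 * N)) : pt i ≠ i := by
  intro h
  have := congrArg Fin.val h
  simp only [pt] at this
  split_ifs at this <;> omega

lemma inter_zero {N : ℕ} {a : Matrix (Fin (2 * N)) (Fin (2 * N)) ℂ}
    (ha : memK N a) (hn : memN N a) : a = 0 := by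
  rw [memK_iff] at ha
  ext i j
  have e : - (sg i * sg j * a (pt j) (pt i)) = a i j := by
    rw [← Jmap_apply, hn]
  rw [Matrix.zero_apply]
  by_cases hij : i = j
  · subst hij
    rw [sg_sq, ha.2 (pt i) i (pt_div i)] at e
    linear_combination (-1/2 : ℂ) * e
  · by_cases h : i.val / 2 ≤ j.val / 2
    · exact ha.1 i j h hij
    · rw [ha.1 (pt j) (pt i) (by rw [pt_div, pt_div]; omega)
        (fun e => hij (by rw [← pt_pt i, ← e, pt_pt]))] at e
      rw [← e]; simp

/-- projection onto k, entrywise -/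
noncomputable def prK {N : ℕ} (a : Matrix (Fin (2 * N)) (Fin (2 * N)) ℂ) :
    Matrix (Fin (2 * N)) (Fin (2 * N)) ℂ :=
  Matrix.of fun i j =>
    if j.val / 2 < i.val / 2 then a i j + sg i * sg j * a (pt j) (pt i)
    else if i.val / 2 = j.val / 2 then (a i j + sg i * sg j * a (pt j) (pt i)) / 2
    else 0

lemma prK_mem {N : ℕ} (a : Matrix (Fin (2 * N)) (Fin (2 * N)) ℂ) : memK N (prK a) := by
  rw [memK_iff]
  refine ⟨fun i j h hne => ?_, fun i j h => ?_⟩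
  · simp only [prK, Matrix.of_apply, if_neg (not_lt.2 h)]
    split_ifs with h2
    · rcases block_cases i j h2 with rfl | rfl
      · exact absurd rfl hne
      · rw [pt_pt, sg_pt]
        linear_combination (-1/2 * a i (pt i)) * sg_sq i
    · rfl
  · rcases block_cases i j h with rfl | rfl
    · rfl
    · simp [prK, pt_pt, sg_sq]
      ring

lemma prN_mem {N : ℕ} (a : Matrix (Fin (2 * N)) (Fin (2 * N)) ℂ) : memN N (a - prK a) := by
  unfold memN
  ext i j
  rw [Jmap_apply]
  simp only [prK, Matrix.sub_apply, Matrix.of_apply, pt_div, pt_pt, sg_pt]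
  have hi := sg_sq i
  have hj := sg_sq j
  have hij : sg i * sg j * (sg j * sg i) = 1 := by
    linear_combination (sg j * sg j) * hi + hj
  rcases lt_trichotomy (i.val / 2) (j.val / 2) with h | h | h
  · rw [if_pos h, if_neg (by omega), if_neg (by omega)]
    linear_combination a i j * hij
  · rw [if_neg (by omega), if_pos h.symm, if_neg (by omega), if_pos h]
    linear_combination (a i j / 2) * hij
  · rw [if_neg (by omega), if_neg (by omega), if_pos h]
    ring

theorem gl_decomposes_as_k_oplus_n (N : ℕ) (hN : 1 ≤ N) :
    (∀ a b : Matrix (Fin (2 * N)) (Fin (2 * N)) ℂ,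
      memK N a → memK N b → memK N (a * b - b * a)) ∧
    (∀ a b : Matrix (Fin (2 * N)) (Fin (2 * N)) ℂ,
      memN N a → memN N b → memN N (a * b - b * a)) ∧
    (∀ a : Matrix (Fin (2 * N)) (Fin (2 * N)) ℂ, memK N a → memN N a → a = 0) ∧
    (∀ a : Matrix (Fin (2 * N)) (Fin (2 * N)) ℂ,
      ∃ p q : Matrix (Fin (2 * N)) (Fin (2 * N)) ℂ,
        memK N p ∧ memN N q ∧ a = p + q ∧
        ∀ p' q' : Matrix (Fin (2 * N)) (Fin (2 * N)) ℂ,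
          memK N p' → memN N q' → a = p' + q' → p' = p ∧ q' = q) := by
  refine ⟨fun a b => memK_comm, fun a b ha hb => ?_, fun a => inter_zero, fun a => ?_⟩
  · unfold memN at *
    rw [Jmap_sub, Jmap_mul, Jmap_mul, ha, hb]
    abel
  · refine ⟨prK a, a - prK a, prK_mem a, prN_mem a, by abel, fun p q hp hq h => ?_⟩
    have e : p - prK a = (a - prK a) - q := by
      conv_rhs => rw [h]
      rw [h]; abel
    have z : p - prK a = 0 :=
      inter_zero (memK_sub hp (prK_mem a)) (by rw [e]; exact memN_sub (prN_mem a) hq)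
    rw [z] at e
    exact ⟨sub_eq_zero.1 z, (sub_eq_zero.1 e.symm).symm⟩
end

section
/- Let g be a Lie algebra over a field of characteristic zero, and let k and n be Lie subalgebras of g such that g = k ⊕ n as vector spaces. Let π_k and π_n denote the linear projections onto k and n determined by this decomposition. Then the bilinear operation [x,y]_R := [π_k x, π_k y] - [π_n x, π_n y] is a Lie bracket on g: it is bilinear, alternating ([x,x]_R = 0), and satisfies the Jacobi identity. Moreover [x,y]_R = (1/2)[Rx, y] + (1/2)[x, Ry], where R = π_k - π_n. -/
theorem R_bracket_is_lie_bracket (K : Type*) [Field K] [CharZero K]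
    (g : Type*) [LieRing g] [LieAlgebra K g]
    (k n : LieSubalgebra K g) (πk πn : g →ₗ[K] g)
    (hπk : ∀ x, πk x ∈ k) (hπn : ∀ x, πn x ∈ n)
    (hsum : ∀ x, πk x + πn x = x)
    (hπkk : ∀ x ∈ k, πk x = x) (hπnn : ∀ x ∈ n, πn x = x) :
    let br : g → g → g := fun x y => ⁅πk x, πk y⁆ - ⁅πn x, πn y⁆
    (∀ x y z : g, br (x + y) z = br x z + br y z) ∧
    (∀ x y z : g, br x (y + z) = br x y + br x z) ∧
    (∀ (c : K) (x y : g), br (c • x) y = c • br x y) ∧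
    (∀ (c : K) (x y : g), br x (c • y) = c • br x y) ∧
    (∀ x : g, br x x = 0) ∧
    (∀ x y z : g, br (br x y) z + br (br y z) x + br (br z x) y = 0) ∧
    (∀ x y : g, br x y =
      (1 / 2 : K) • ⁅πk x - πn x, y⁆ + (1 / 2 : K) • ⁅x, πk y - πn y⁆) := by
  have hkn : ∀ x ∈ n, πk x = 0 := fun x hx => by
    have h := hsum x
    rw [hπnn x hx] at h
    simpa using h
  have hnk : ∀ x ∈ k, πn x = 0 := fun x hx => by
    have h := hsum x
    rw [hπkk x hx] at h
    simpa using h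
  have J : ∀ a b c : g, ⁅⁅a, b⁆, c⁆ + ⁅⁅b, c⁆, a⁆ + ⁅⁅c, a⁆, b⁆ = 0 := fun a b c => by
    have h := lie_jacobi a b c
    rw [← lie_skew a ⁅b, c⁆, ← lie_skew b ⁅c, a⁆, ← lie_skew c ⁅a, b⁆] at h
    rw [← neg_eq_zero, ← h]
    abel
  intro br
  have hk : ∀ x y, πk (br x y) = ⁅πk x, πk y⁆ := fun x y => by
    simp only [br, map_sub]
    rw [hπkk _ (k.lie_mem (hπk x) (hπk y)), hkn _ (n.lie_mem (hπn x) (hπn y)), sub_zero]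
  have hn : ∀ x y, πn (br x y) = -⁅πn x, πn y⁆ := fun x y => by
    simp only [br, map_sub]
    rw [hnk _ (k.lie_mem (hπk x) (hπk y)), hπnn _ (n.lie_mem (hπn x) (hπn y)), zero_sub]
  have hbb : ∀ x y z, br (br x y) z = ⁅⁅πk x, πk y⁆, πk z⁆ + ⁅⁅πn x, πn y⁆, πn z⁆ :=
    fun x y z => by
      change ⁅πk (br x y), πk z⁆ - ⁅πn (br x y), πn z⁆ = _
      rw [hk, hn, neg_lie, sub_neg_eq_add]
  refine ⟨?_, ?_, ?_, ?_, ?_, ?_, ?_⟩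
  · intro x y z
    simp only [br, map_add, add_lie]
    abel
  · intro x y z
    simp only [br, map_add, lie_add]
    abel
  · intro c x y
    simp only [br, map_smul, smul_lie, smul_sub]
  · intro c x y
    simp only [br, map_smul, lie_smul, smul_sub]
  · intro x
    simp only [br, lie_self, sub_zero]
  · intro x y z
    rw [hbb, hbb, hbb]
    have h1 := J (πk x) (πk y) (πk z)
    have h2 := J (πn x) (πn y) (πn z)
    rw [← add_zero (0 : g)]
    nth_rewrite 1 [← h1]
    rw [← h2]
    abel
  · intro x y
    have hx : ⁅πk x - πn x, y⁆ = ⁅πk x - πn x, πk y + πn y⁆ := by rw [hsum]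
    have hy : ⁅x, πk y - πn y⁆ = ⁅πk x + πn x, πk y - πn y⁆ := by rw [hsum]
    rw [hx, hy]
    simp only [br, add_lie, sub_lie, lie_add, lie_sub]
    module
end

section
/- Assume τ_{2m} ≠ 0 for all m. Then for every n ≥ 0: (a) ⟨p_{2n}(z), z^i⟩ = 0 for 0 ≤ i ≤ 2n, and ⟨p_{2n}(z), z^i⟩ = pf(0,…,2n,i)/τ_{2n} for every i > 2n; (b) ⟨p_{2n+1}(z), z^i⟩ = 0 for 0 ≤ i ≤ 2n+1 with i ≠ 2n, and ⟨p_{2n+1}(z), z^{2n}⟩ = -τ_{2n+2}/τ_{2n}. -/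
open Matrix

/-- The Pfaffian of a `2m×2m` matrix `A`, defined by the permutation sum
`pf(A) = (1/(2^m m!)) Σ_{σ} sgn(σ) A_{σ(0)σ(1)} A_{σ(2)σ(3)} ⋯ A_{σ(2m-2)σ(2m-1)}`. -/
noncomputable def pf (m : ℕ) (A : Matrix (Fin (2 * m)) (Fin (2 * m)) ℂ) : ℂ :=
  (1 / ((2 : ℂ) ^ m * (Nat.factorial m : ℂ))) *
    ∑ σ : Equiv.Perm (Fin (2 * m)),
      ((Equiv.Perm.sign σ : ℤ) : ℂ) *
        ∏ p : Fin m,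
          A (σ ⟨2 * p.val, by have := p.isLt; omega⟩)
            (σ ⟨2 * p.val + 1, by have := p.isLt; omega⟩)

/-- `pf(j₀,…,j_{2m-1})`: the Pfaffian of the `2m×2m` skew-symmetric matrix
`(μ_{j_a j_b})` built from the array `μ` and the index list `v`. -/
noncomputable def pfv (m : ℕ) (μ : ℕ → ℕ → ℂ) (v : Fin (2 * m) → ℕ) : ℂ :=
  pf m (Matrix.of fun a b => μ (v a) (v b))
/-- `τ_{2n} = pf(0,1,…,2n-1)` (so `τ₀ = 1`). -/
noncomputable def tau (μ : ℕ → ℕ → ℂ) (n : ℕ) : ℂ :=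
  pfv n μ (fun a => a.val)

/-- `pf(0,…,k̂,…,2n)`. -/
noncomputable def pfOmitEven (μ : ℕ → ℕ → ℂ) (n k : ℕ) : ℂ :=
  pfv n μ (fun a => if a.val < k then a.val else a.val + 1)

/-- `pf(0,…,k̂,…,2n-1,2n+1)`. -/
noncomputable def pfOmitOdd (μ : ℕ → ℕ → ℂ) (n k : ℕ) : ℂ :=
  pfv n μ (fun a =>
    if a.val < k then a.val
    else if a.val < 2 * n - 1 then a.val + 1
    else 2 * n + 1)

/-- The monic polynomial `p_{2n}(z) = (1/τ_{2n}) Σ_{k=0}^{2n} (-z)^k pf(0,…,k̂,…,2n)`. -/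
noncomputable def pEven (μ : ℕ → ℕ → ℂ) (n : ℕ) : Polynomial ℂ :=
  Polynomial.C (tau μ n)⁻¹ *
    ∑ k ∈ Finset.range (2 * n + 1),
      Polynomial.C ((-1) ^ k * pfOmitEven μ n k) * Polynomial.X ^ k

/-- The monic polynomial
`p_{2n+1}(z) = z^{2n+1} + (1/τ_{2n}) Σ_{k=0}^{2n-1} (-z)^k pf(0,…,k̂,…,2n-1,2n+1)`. -/
noncomputable def pOdd (μ : ℕ → ℕ → ℂ) (n : ℕ) : Polynomial ℂ :=
  Polynomial.X ^ (2 * n + 1) +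
    Polynomial.C (tau μ n)⁻¹ *
      ∑ k ∈ Finset.range (2 * n),
        Polynomial.C ((-1) ^ k * pfOmitOdd μ n k) * Polynomial.X ^ k

/-- The skew inner product `⟨Σ aᵢ zⁱ, Σ bⱼ zʲ⟩ = Σ aᵢ bⱼ μ_{ij}` on polynomials. -/
noncomputable def skewForm (μ : ℕ → ℕ → ℂ) (p q : Polynomial ℂ) : ℂ :=
  ∑ i ∈ Finset.range (p.natDegree + 1), ∑ j ∈ Finset.range (q.natDegree + 1),
    p.coeff i * q.coeff j * μ i j

def PhiP {m : ℕ} (k : Fin (m+1)) (ρ : Equiv.Perm (Fin m)) : Equiv.Perm (Fin (m+1)) :=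
  ((finSuccEquiv' (Fin.last m)).trans (Equiv.optionCongr ρ)).trans (finSuccEquiv' k).symm

theorem PhiP_last {m : ℕ} (k : Fin (m+1)) (ρ : Equiv.Perm (Fin m)) :
    PhiP k ρ (Fin.last m) = k := by
  simp [PhiP]

theorem PhiP_castSucc {m : ℕ} (k : Fin (m+1)) (ρ : Equiv.Perm (Fin m)) (a : Fin m) :
    PhiP k ρ a.castSucc = k.succAbove (ρ a) := by
  have h : finSuccEquiv' (Fin.last m) a.castSucc = some a := finSuccEquiv'_last_apply_castSucc a
  simp [PhiP, h]

theorem PhiP_bij (m : ℕ) : Function.Bijective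
    (fun x : Fin (m+1) × Equiv.Perm (Fin m) => PhiP x.1 x.2) := by
  rw [Fintype.bijective_iff_injective_and_card]
  refine ⟨?_, by simp [Fintype.card_perm, Nat.factorial_succ]⟩
  rintro ⟨k, ρ⟩ ⟨k', ρ'⟩ h
  simp only at h
  have h1 : k = k' := by rw [← PhiP_last k ρ, h, PhiP_last]
  subst h1
  have h2 : ρ = ρ' := by
    ext a
    have := PhiP_castSucc k ρ a
    rw [h, PhiP_castSucc] at this
    rw [Fin.succAbove_right_injective this]
  rw [h2]

theorem PhiP_sign_last {m : ℕ} (ρ : Equiv.Perm (Fin m)) :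
    Equiv.Perm.sign (PhiP (Fin.last m) ρ) = Equiv.Perm.sign ρ := by
  rw [← Equiv.optionCongr_sign ρ]
  exact Equiv.Perm.sign_trans_trans_symm _ _

theorem PhiP_mul {m : ℕ} (k : Fin (m+1)) (ρ : Equiv.Perm (Fin m)) :
    PhiP k ρ = Fin.cycleIcc k (Fin.last m) * PhiP (Fin.last m) ρ := by
  apply Equiv.ext
  intro x
  induction x using Fin.lastCases with
  | last => rw [PhiP_last, Equiv.Perm.mul_apply, PhiP_last, Fin.cycleIcc_of_last (Fin.le_last k)]
  | cast a =>
    rw [PhiP_castSucc, Equiv.Perm.mul_apply, PhiP_castSucc]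
    exact (congrFun (Fin.cycleIcc_comp_succAbove k (Fin.last m) (Fin.le_last k)) (ρ a)).symm

theorem PhiP_sign {m : ℕ} (k : Fin (m+1)) (ρ : Equiv.Perm (Fin m)) :
    Equiv.Perm.sign (PhiP k ρ) = (-1) ^ (m - k.val) * Equiv.Perm.sign ρ := by
  rw [PhiP_mul, Equiv.Perm.sign_mul, PhiP_sign_last, Fin.sign_cycleIcc_of_le (Fin.le_last k)]
  simp

theorem sum_PhiP {m : ℕ} (f : Equiv.Perm (Fin (m+1)) → ℂ) :
    ∑ σ, f σ = ∑ k, ∑ ρ, f (PhiP k ρ) := by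
  rw [← (PhiP_bij m).sum_comp f, Fintype.sum_prod_type]

def ev {m : ℕ} (p : Fin m) : Fin (2 * m) := ⟨2 * p.val, by have := p.isLt; omega⟩
def od {m : ℕ} (p : Fin m) : Fin (2 * m) := ⟨2 * p.val + 1, by have := p.isLt; omega⟩

noncomputable def tm {m : ℕ} (A : Matrix (Fin (2 * m)) (Fin (2 * m)) ℂ)
    (σ : Equiv.Perm (Fin (2 * m))) : ℂ :=
  ((Equiv.Perm.sign σ : ℤ) : ℂ) * ∏ p : Fin m, A (σ (ev p)) (σ (od p))

theorem pf_eq (m : ℕ) (A : Matrix (Fin (2 * m)) (Fin (2 * m)) ℂ) :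
    pf m A = (1 / ((2 : ℂ) ^ m * (Nat.factorial m : ℂ))) * ∑ σ, tm A σ := rfl

theorem ev_inj {m : ℕ} {p q : Fin m} : ev p = ev q ↔ p = q := by
  simp [ev, Fin.ext_iff]
theorem od_inj {m : ℕ} {p q : Fin m} : od p = od q ↔ p = q := by
  simp [od, Fin.ext_iff]
theorem ev_ne_od {m : ℕ} (p q : Fin m) : ev p ≠ od q := by
  simp only [ev, od, ne_eq, Fin.ext_iff]; omega

/-- invariance under block swap -/
theorem tm_block {m : ℕ} (A : Matrix (Fin (2 * m)) (Fin (2 * m)) ℂ) (p q : Fin m)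
    (σ : Equiv.Perm (Fin (2 * m))) :
    tm A (σ * (Equiv.swap (ev p) (ev q) * Equiv.swap (od p) (od q))) = tm A σ := by
  have hs : Equiv.Perm.sign (Equiv.swap (ev p) (ev q) * Equiv.swap (od p) (od q)) = 1 := by
    by_cases h : p = q
    · subst h; simp
    · rw [Equiv.Perm.sign_mul, Equiv.Perm.sign_swap (by rwa [Ne, ev_inj]),
        Equiv.Perm.sign_swap (by rwa [Ne, od_inj])]; simp
  have he : ∀ r, (Equiv.swap (ev p) (ev q) * Equiv.swap (od p) (od q)) (ev r)
      = ev (Equiv.swap p q r) := by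
    intro r
    rw [Equiv.Perm.mul_apply, Equiv.swap_apply_of_ne_of_ne (ev_ne_od _ _) (ev_ne_od _ _)]
    simp only [Equiv.swap_apply_def, ev_inj]
    split_ifs <;> rfl
  have ho : ∀ r, (Equiv.swap (ev p) (ev q) * Equiv.swap (od p) (od q)) (od r)
      = od (Equiv.swap p q r) := by
    intro r
    have : Equiv.swap (od p) (od q) (od r) = od (Equiv.swap p q r) := by
      simp only [Equiv.swap_apply_def, od_inj]
      split_ifs <;> rfl
    rw [Equiv.Perm.mul_apply, this, Equiv.swap_apply_of_ne_of_ne (ev_ne_od _ _).symm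
      (ev_ne_od _ _).symm]
  unfold tm
  rw [Equiv.Perm.sign_mul, hs, mul_one]
  congr 1
  simp only [Equiv.Perm.mul_apply σ, he, ho]
  exact Equiv.prod_comp (Equiv.swap p q) (fun r => A (σ (ev r)) (σ (od r)))

theorem tm_flip {m : ℕ} (A : Matrix (Fin (2 * m)) (Fin (2 * m)) ℂ)
    (hA : ∀ i j, A i j = - A j i) (p : Fin m) (σ : Equiv.Perm (Fin (2 * m))) :
    tm A (σ * Equiv.swap (ev p) (od p)) = tm A σ := by
  unfold tm
  rw [Equiv.Perm.sign_mul, Equiv.Perm.sign_swap (ev_ne_od p p),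
    ← Finset.mul_prod_erase _ _ (Finset.mem_univ p),
    ← Finset.mul_prod_erase Finset.univ (fun p => A (σ (ev p)) (σ (od p))) (Finset.mem_univ p)]
  have : ∏ x ∈ Finset.univ.erase p, A ((σ * Equiv.swap (ev p) (od p)) (ev x))
        ((σ * Equiv.swap (ev p) (od p)) (od x)) =
      ∏ x ∈ Finset.univ.erase p, A (σ (ev x)) (σ (od x)) := by
    refine Finset.prod_congr rfl fun x hx => ?_
    have hx : x ≠ p := Finset.ne_of_mem_erase hx
    rw [Equiv.Perm.mul_apply, Equiv.Perm.mul_apply,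
      Equiv.swap_apply_of_ne_of_ne (by rwa [Ne, ev_inj]) (ev_ne_od _ _),
      Equiv.swap_apply_of_ne_of_ne (ev_ne_od _ _).symm (by rwa [Ne, od_inj])]
  rw [this]
  simp only [Equiv.Perm.mul_apply, Equiv.swap_apply_left, Equiv.swap_apply_right]
  rw [hA (σ (od p)) (σ (ev p))]
  push_cast
  ring

theorem exists_g {m : ℕ} (A : Matrix (Fin (2 * m)) (Fin (2 * m)) ℂ)
    (hA : ∀ i j, A i j = - A j i) (q : Fin m) (j : Fin (2 * m)) :
    ∃ g : Equiv.Perm (Fin (2 * m)), g (od q) = j ∧ ∀ σ, tm A (σ * g) = tm A σ := by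
  obtain ⟨p, hp | hp⟩ : ∃ p : Fin m, j = ev p ∨ j = od p := by
    refine ⟨⟨j.val / 2, by omega⟩, ?_⟩
    simp only [ev, od, Fin.ext_iff]; omega
  · refine ⟨Equiv.swap (ev p) (od p) * (Equiv.swap (ev p) (ev q) * Equiv.swap (od p) (od q)),
      ?_, fun σ => ?_⟩
    · rw [Equiv.Perm.mul_apply, Equiv.Perm.mul_apply, Equiv.swap_apply_right,
        Equiv.swap_apply_of_ne_of_ne (ev_ne_od _ _).symm (ev_ne_od _ _).symm,
        Equiv.swap_apply_right, hp]
    · rw [← mul_assoc, tm_block, tm_flip A hA]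
  · refine ⟨(Equiv.swap (ev p) (ev q) * Equiv.swap (od p) (od q)),
      ?_, fun σ => ?_⟩
    · rw [Equiv.Perm.mul_apply, Equiv.swap_apply_right,
        Equiv.swap_apply_of_ne_of_ne (ev_ne_od _ _).symm (ev_ne_od _ _).symm, hp]
    · rw [tm_block]

theorem sum_tm {m : ℕ} (A : Matrix (Fin (2 * m)) (Fin (2 * m)) ℂ)
    (hA : ∀ i j, A i j = - A j i) (q : Fin m) :
    ∑ σ, tm A σ = (2 * m : ℂ) * ∑ σ, if σ (od q) = od q then tm A σ else 0 := by
  have h1 : ∀ j : Fin (2*m), (∑ σ : Equiv.Perm (Fin (2*m)), if σ j = od q then tm A σ else 0)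
      = ∑ σ : Equiv.Perm (Fin (2*m)), if σ (od q) = od q then tm A σ else 0 := by
    intro j
    obtain ⟨g, hg, hinv⟩ := exists_g A hA q j
    rw [← Equiv.sum_comp (Equiv.mulRight g)
      (fun σ : Equiv.Perm (Fin (2*m)) => if σ (od q) = od q then tm A σ else 0),
      ← Equiv.sum_comp (Equiv.mulRight g⁻¹)
      (fun σ : Equiv.Perm (Fin (2*m)) => if σ j = od q then tm A σ else 0)]
    rw [← Equiv.sum_comp (Equiv.mulRight g)]
    rw [← Equiv.sum_comp (Equiv.mulRight g)]
    rw [← Equiv.sum_comp (Equiv.mulRight g⁻¹)]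
    refine Finset.sum_congr rfl fun σ _ => ?_
    simp [hinv, Equiv.Perm.mul_apply, hg]
  calc ∑ σ, tm A σ = ∑ σ : Equiv.Perm (Fin (2*m)), ∑ j, if σ j = od q then tm A σ else 0 := by
        refine Finset.sum_congr rfl fun σ _ => ?_
        rw [Finset.sum_eq_single (σ.symm (od q))]
        · simp
        · intro b _ hb
          rw [if_neg]
          rintro h
          exact hb (by rw [← h]; simp)
        · simp
    _ = _ := by
        rw [Finset.sum_comm]
        simp only [h1]
        simp

theorem pf_succ (n : ℕ) (A : Matrix (Fin (2 * (n+1))) (Fin (2 * (n+1))) ℂ)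
    (hA : ∀ i j, A i j = - A j i) :
    pf (n+1) A = ∑ k : Fin (2 * n + 1), (-1) ^ k.val *
      A (Fin.castSucc (n := 2*n+1) k) (Fin.last (2*n+1)) *
      pf n (Matrix.of fun a b => A (Fin.castSucc (n := 2*n+1) (k.succAbove a))
        (Fin.castSucc (n := 2*n+1) (k.succAbove b))) := by
  have hL : od (Fin.last n) = (Fin.last (2*n+1) : Fin (2*n+1+1)) := rfl
  have hsum : (∑ σ : Equiv.Perm (Fin (2*(n+1))),
        if σ (od (Fin.last n)) = od (Fin.last n) then tm A σ else 0) =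
      ∑ k : Fin (2*n+1), ∑ ρ : Equiv.Perm (Fin (2*n)),
        tm A (PhiP (m := 2*n+1) (Fin.last _) (PhiP k ρ)) := by
    rw [hL]
    refine (sum_PhiP (m := 2*n+1) _).trans ?_
    simp only [PhiP_last]
    rw [Finset.sum_eq_single (Fin.last (2*n+1))]
    · refine (sum_PhiP (m := 2*n) _).trans ?_
      simp
    · intro b _ hb
      refine Finset.sum_eq_zero fun ρ _ => if_neg ?_
      exact hb
    · simp
  have hterm : ∀ (k : Fin (2*n+1)) (ρ : Equiv.Perm (Fin (2*n))),
      tm A (PhiP (m := 2*n+1) (Fin.last _) (PhiP k ρ)) = (-1) ^ k.val *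
      A (Fin.castSucc (n := 2*n+1) k) (Fin.last (2*n+1)) *
      tm (Matrix.of fun a b => A (Fin.castSucc (n := 2*n+1) (k.succAbove a))
        (Fin.castSucc (n := 2*n+1) (k.succAbove b))) ρ := by
    intro k ρ
    have e1 : Equiv.Perm.sign (PhiP (m := 2*n+1) (Fin.last _) (PhiP k ρ))
        = (-1) ^ k.val * Equiv.Perm.sign ρ := by
      rw [PhiP_sign_last, PhiP_sign]
      congr 1
      have := k.isLt
      have hp : Even (2 * n - k.val + k.val) := by
        rw [Nat.sub_add_cancel (by omega)]; exact even_two_mul n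
      rcases Nat.even_or_odd k.val with hk | hk
      · rw [hk.neg_one_pow, ((Nat.even_add.mp hp).mpr hk).neg_one_pow]
      · rw [hk.neg_one_pow, Odd.neg_one_pow]
        rw [← Nat.not_even_iff_odd] at hk ⊢
        exact fun h => hk ((Nat.even_add.mp hp).mp h)
    have e2 : ∀ a : Fin (2*n), PhiP (m := 2*n+1) (Fin.last _) (PhiP k ρ) a.castSucc.castSucc
        = (k.succAbove (ρ a)).castSucc := by
      intro a
      rw [PhiP_castSucc, PhiP_castSucc, Fin.succAbove_last]
    have e3 : PhiP (m := 2*n+1) (Fin.last _) (PhiP k ρ) (Fin.last (2*n)).castSucc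
        = k.castSucc := by
      rw [PhiP_castSucc, PhiP_last, Fin.succAbove_last]
    have e4 : PhiP (m := 2*n+1) (Fin.last _) (PhiP k ρ) (Fin.last (2*n+1))
        = Fin.last _ := PhiP_last _ _
    unfold tm
    rw [Fin.prod_univ_castSucc]
    have e5 : ∀ a : Fin n, (ev a.castSucc : Fin (2*(n+1))) =
      Fin.castSucc (n := 2*n+1) (Fin.castSucc (ev a)) := fun a => rfl
    have e6 : ∀ a : Fin n, (od a.castSucc : Fin (2*(n+1))) =
      Fin.castSucc (n := 2*n+1) (Fin.castSucc (od a)) := fun a => rfl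
    have e7 : (ev (Fin.last n) : Fin (2*(n+1))) =
      Fin.castSucc (n := 2*n+1) (Fin.last (2*n)) := rfl
    simp only [e5, e6, e7, hL]
    erw [e1, e3, e4]
    simp only [Matrix.of_apply]
    have e8 : (∏ x : Fin n, A ((PhiP (m := 2*n+1) (Fin.last _) (PhiP k ρ)) (ev x).castSucc.castSucc)
         ((PhiP (m := 2*n+1) (Fin.last _) (PhiP k ρ)) (od x).castSucc.castSucc)) =
       ∏ x : Fin n, A (k.succAbove (ρ (ev x))).castSucc (k.succAbove (ρ (od x))).castSucc := by
      refine Finset.prod_congr rfl fun x _ => ?_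
      rw [e2, e2]
    erw [e8]
    push_cast
    ring
  rw [pf_eq, sum_tm A hA (Fin.last n), hsum]
  simp only [hterm, pf_eq, ← Finset.mul_sum]
  rw [Finset.mul_sum, Finset.mul_sum]
  refine Finset.sum_congr rfl fun k _ => ?_
  rw [Nat.factorial_succ]
  have h1 : (n:ℂ) + 1 ≠ 0 := by exact_mod_cast Nat.succ_ne_zero n
  have h2 : (n.factorial : ℂ) ≠ 0 := by exact_mod_cast Nat.factorial_ne_zero n
  push_cast
  field_simp
  ring

theorem pfv_perm (m : ℕ) (μ : ℕ → ℕ → ℂ) (v : Fin (2 * m) → ℕ) (π : Equiv.Perm (Fin (2*m))) :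
    pfv m μ (v ∘ π) = ((Equiv.Perm.sign π : ℤ) : ℂ) * pfv m μ v := by
  unfold pfv
  rw [pf_eq, pf_eq, ← Equiv.sum_comp (Equiv.mulLeft π) (tm (Matrix.of fun a b => μ (v a) (v b))),
    mul_left_comm]
  congr 1
  rw [Finset.mul_sum]
  refine Finset.sum_congr rfl fun (σ : Equiv.Perm (Fin (2*m))) _ => ?_
  simp only [tm, Equiv.coe_mulLeft, Equiv.Perm.sign_mul, Matrix.of_apply, Function.comp,
    Equiv.Perm.mul_apply]
  have : ((Equiv.Perm.sign π : ℤ) : ℂ) * ((Equiv.Perm.sign π : ℤ) : ℂ) = 1 := by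
    norm_cast
    simp
  push_cast
  rw [← mul_assoc, ← mul_assoc, this, one_mul]

theorem pfv_rep (m : ℕ) (μ : ℕ → ℕ → ℂ) (v : Fin (2 * m) → ℕ) (a b : Fin (2*m))
    (hab : a ≠ b) (h : v a = v b) : pfv m μ v = 0 := by
  have h1 := pfv_perm m μ v (Equiv.swap a b)
  have h2 : v ∘ Equiv.swap a b = v := by
    funext x
    simp only [Function.comp, Equiv.swap_apply_def]
    split_ifs with h1 h2
    · rw [h1, h]
    · rw [h2, h]
    · rfl
  rw [h2, Equiv.Perm.sign_swap hab] at h1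
  push_cast at h1
  linear_combination h1 / 2

theorem skewForm_eq (μ : ℕ → ℕ → ℂ) (p : Polynomial ℂ) (i : ℕ) :
    skewForm μ p (Polynomial.X ^ i) =
      Polynomial.lsum (R := ℂ) (A := ℂ) (M := ℂ) (fun k => (LinearMap.mulRight ℂ (μ k i))) p := by
  rw [Polynomial.lsum_apply, Polynomial.sum_over_range _ (by simp)]
  unfold skewForm
  refine Finset.sum_congr rfl fun k _ => ?_
  rw [Finset.sum_eq_single i]
  · simp
  · intro b _ hb; simp [Polynomial.coeff_X_pow, hb]
  · simp

theorem lsum_mono (f : ℕ → ℂ →ₗ[ℂ] ℂ) (c : ℂ) (k : ℕ) :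
    Polynomial.lsum f (Polynomial.C c * Polynomial.X ^ k) = f k c := by
  rw [Polynomial.lsum_apply, Polynomial.C_mul_X_pow_eq_monomial, Polynomial.sum_monomial_index]
  simp

theorem form_even (μ : ℕ → ℕ → ℂ) (hskew : ∀ i j, μ i j = -μ j i) (n i : ℕ) :
    skewForm μ (pEven μ n) (Polynomial.X ^ i) =
      pfv (n + 1) μ (fun a => if a.val ≤ 2 * n then a.val else i) / tau μ n := by
  rw [skewForm_eq, pEven, ← Polynomial.smul_eq_C_mul, map_smul, map_sum, div_eq_inv_mul,
    smul_eq_mul]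
  congr 1
  simp only [lsum_mono, LinearMap.mulRight_apply]
  unfold pfv
  rw [pf_succ _ (Matrix.of _) (fun a b => hskew _ _), Finset.sum_range]
  refine Finset.sum_congr rfl fun k _ => ?_
  have hk := k.isLt
  simp only [Matrix.of_apply, Fin.val_castSucc, Fin.val_last]
  rw [if_pos (by omega), if_neg (by omega)]
  rw [mul_right_comm]
  congr 1
  unfold pfOmitEven pfv
  congr 1
  ext a b
  simp only [Matrix.of_apply]
  have key : ∀ a : Fin (2*n), (if (k.succAbove a).val ≤ 2 * n then (k.succAbove a).val else i)
      = if a.val < k.val then a.val else a.val + 1 := by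
    intro a
    have := (k.succAbove a).isLt
    rw [if_pos (by omega)]
    simp only [Fin.succAbove, Fin.lt_def, Fin.val_castSucc]
    split_ifs <;> simp
  rw [key, key]

theorem form_odd (μ : ℕ → ℕ → ℂ) (hskew : ∀ i j, μ i j = -μ j i) (n i : ℕ)
    (ht : tau μ n ≠ 0) :
    skewForm μ (pOdd μ n) (Polynomial.X ^ i) =
      pfv (n + 1) μ (fun a => if a.val < 2 * n then a.val else
        if a.val = 2 * n then 2 * n + 1 else i) / tau μ n := by
  rw [skewForm_eq, pOdd, ← Polynomial.smul_eq_C_mul, map_add, map_smul, map_sum, div_eq_inv_mul,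
    smul_eq_mul, ← one_mul (Polynomial.X ^ (2*n+1)), ← Polynomial.C_1]
  simp only [lsum_mono, LinearMap.mulRight_apply]
  unfold pfv
  rw [pf_succ _ (Matrix.of _) (fun a b => hskew _ _), Fin.sum_univ_castSucc, mul_add, add_comm,
    Finset.sum_range]
  congr 1
  · congr 1
    refine Finset.sum_congr rfl fun k _ => ?_
    have hk := k.isLt
    simp only [Matrix.of_apply, Fin.val_castSucc, Fin.val_last]
    rw [if_pos (by omega), if_neg (by omega), if_neg (by omega)]
    rw [mul_right_comm]
    congr 1
    unfold pfOmitOdd pfv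
    congr 1
    ext a b
    simp only [Matrix.of_apply]
    have key : ∀ a : Fin (2*n), (if (k.castSucc.succAbove a).val < 2 * n then
        (k.castSucc.succAbove a).val else
          if (k.castSucc.succAbove a).val = 2 * n then 2 * n + 1 else i)
        = if a.val < k.val then a.val else if a.val < 2 * n - 1 then a.val + 1 else 2 * n + 1 := by
      intro a
      have := a.isLt
      simp only [Fin.succAbove, Fin.lt_def, Fin.val_castSucc]
      split_ifs <;> simp at * <;> omega
    rw [key, key]
  · simp only [Matrix.of_apply, Fin.val_castSucc, Fin.val_last, Fin.succAbove_last, Fin.is_lt,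
      if_true]
    rw [if_neg (by omega), if_neg (by omega), if_neg (by omega)]
    have : pf n (Matrix.of fun a b : Fin (2*n) => μ a.val b.val) = tau μ n := rfl
    rw [this]
    simp
    field_simp

theorem skew_orthogonality_with_monomials (μ : ℕ → ℕ → ℂ)
    (hskew : ∀ i j, μ i j = -μ j i) (htau : ∀ m, tau μ m ≠ 0) (n : ℕ) :
    (∀ i ≤ 2 * n, skewForm μ (pEven μ n) (Polynomial.X ^ i) = 0) ∧
    (∀ i, 2 * n < i →
      skewForm μ (pEven μ n) (Polynomial.X ^ i) =
        pfv (n + 1) μ (fun a => if a.val ≤ 2 * n then a.val else i) / tau μ n) ∧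
    (∀ i ≤ 2 * n + 1, i ≠ 2 * n →
      skewForm μ (pOdd μ n) (Polynomial.X ^ i) = 0) ∧
    skewForm μ (pOdd μ n) (Polynomial.X ^ (2 * n)) = -(tau μ (n + 1) / tau μ n) := by
  refine ⟨?_, ?_, ?_, ?_⟩
  · intro i hi
    rw [form_even μ hskew, pfv_rep (n+1) μ _ ⟨i, by omega⟩ ⟨2*n+1, by omega⟩, zero_div]
    · simp only [ne_eq, Fin.mk.injEq]; omega
    · simp [hi]
  · intro i _
    exact form_even μ hskew n i
  · intro i hi hi2
    rw [form_odd μ hskew n i (htau n)]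
    by_cases h : i = 2 * n + 1
    · rw [pfv_rep (n+1) μ _ ⟨2*n, by omega⟩ ⟨2*n+1, by omega⟩, zero_div]
      · simp only [ne_eq, Fin.mk.injEq]; omega
      · simp [h]
    · rw [pfv_rep (n+1) μ _ ⟨i, by omega⟩ ⟨2*n+1, by omega⟩, zero_div]
      · simp only [ne_eq, Fin.mk.injEq]; omega
      · have : i < 2 * n := by omega
        simp [this]
  · rw [form_odd μ hskew n _ (htau n), ← neg_div]
    congr 1
    have h := pfv_perm (n+1) μ (fun a => a.val)
      (Equiv.swap ⟨2*n, by omega⟩ ⟨2*n+1, by omega⟩)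
    rw [Equiv.Perm.sign_swap (by simp)] at h
    have h2 : ((fun a : Fin (2*(n+1)) => a.val) ∘
        (Equiv.swap ⟨2*n, by omega⟩ ⟨2*n+1, by omega⟩ : Equiv.Perm (Fin (2*(n+1))))) =
        (fun a => if a.val < 2 * n then a.val else
        if a.val = 2 * n then 2 * n + 1 else 2 * n) := by
      funext a
      have := a.isLt
      simp only [Function.comp, Equiv.swap_apply_def, Fin.ext_iff]
      split_ifs <;> (try simp only) <;> omega
    rw [h2] at h
    rw [h, tau]
    push_cast
    ring
end

section
/- Fix an integer k ≥ 1. Let μ_{ij} : ℝ → ℂ (i,j ≥ 0) be differentiable functions with μ_{ij}(t) = -μ_{ji}(t) for all t, satisfying the system μ_{ij}'(t) = μ_{i+k,j}(t) + μ_{i,j+k}(t). Then for every even-length index list (i₀,…,i_{n-1}) of nonnegative integers, the Pfaffian pf(i₀,…,i_{n-1}) (computed from μ(t)) is differentiable in t and d/dt pf(i₀,…,i_{n-1}) = Σ_{r=0}^{n-1} pf(i₀,…,i_{r-1}, i_r + k, i_{r+1},…,i_{n-1}). -/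
open Matrix

theorem sum_fin_two_mul {m : ℕ} (f : Fin (2 * m) → ℂ) :
    ∑ r, f r = ∑ p : Fin m, (f ⟨2 * p.val, by have := p.isLt; omega⟩ +
      f ⟨2 * p.val + 1, by have := p.isLt; omega⟩) := by
  rw [← (finProdFinEquiv.trans (finCongr (mul_comm m 2))).sum_comp f, Fintype.sum_prod_type]
  refine Finset.sum_congr rfl fun p _ => ?_
  rw [Fin.sum_univ_two]
  congr 2 <;> ext <;> simp [finProdFinEquiv] <;> omega

theorem perm_term (k m : ℕ) (M : ℕ → ℕ → ℂ) (v : Fin (2 * m) → ℕ)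
    (σ : Equiv.Perm (Fin (2 * m))) :
    ∑ r : Fin (2 * m), ∏ p : Fin m,
      M (Function.update v r (v r + k) (σ ⟨2 * p.val, by have := p.isLt; omega⟩))
        (Function.update v r (v r + k) (σ ⟨2 * p.val + 1, by have := p.isLt; omega⟩)) =
    ∑ p : Fin m, (∏ q ∈ Finset.univ.erase p,
      M (v (σ ⟨2 * q.val, by have := q.isLt; omega⟩))
        (v (σ ⟨2 * q.val + 1, by have := q.isLt; omega⟩))) *
      (M (v (σ ⟨2 * p.val, by have := p.isLt; omega⟩) + k)
        (v (σ ⟨2 * p.val + 1, by have := p.isLt; omega⟩)) +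
       M (v (σ ⟨2 * p.val, by have := p.isLt; omega⟩))
        (v (σ ⟨2 * p.val + 1, by have := p.isLt; omega⟩) + k)) := by
  rw [← Equiv.sum_comp σ, sum_fin_two_mul]
  refine Finset.sum_congr rfl fun p _ => ?_
  rw [mul_add]
  congr 1
  all_goals
    rw [← Finset.prod_erase_mul _ _ (Finset.mem_univ p)]
    congr 1
    · refine Finset.prod_congr rfl fun q hq => ?_
      have hne : q.val ≠ p.val := fun h => (Finset.mem_erase.1 hq).1 (Fin.ext h)
      rw [Function.update_of_ne, Function.update_of_ne] <;>
      · intro h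
        have := congrArg Fin.val (σ.injective h)
        simp only at this
        omega
    · rw [Function.update_self, Function.update_of_ne]
      intro h
      have := congrArg Fin.val (σ.injective h)
      simp only at this
      omega

theorem deriv_of_pfaffian (k : ℕ) (hk : 1 ≤ k) (μ : ℕ → ℕ → ℝ → ℂ)
    (hskew : ∀ i j t, μ i j t = -μ j i t)
    (hderiv : ∀ i j t, HasDerivAt (μ i j) (μ (i + k) j t + μ i (j + k) t) t)
    (m : ℕ) (v : Fin (2 * m) → ℕ) (t : ℝ) :
    HasDerivAt (fun s => pfv m (fun i j => μ i j s) v)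
      (∑ r : Fin (2 * m),
        pfv m (fun i j => μ i j t) (Function.update v r (v r + k))) t := by
  simp only [pfv, pf, Matrix.of_apply]
  rw [← Finset.mul_sum, Finset.sum_comm]
  refine HasDerivAt.const_mul _ (HasDerivAt.fun_sum fun σ _ => ?_)
  rw [← Finset.mul_sum, perm_term k m (fun i j => μ i j t) v σ]
  refine HasDerivAt.const_mul _ ?_
  simpa only [smul_eq_mul] using HasDerivAt.fun_finsetProd (u := Finset.univ) fun p _ => hderiv _ _ t
end

section
/- Let μ_{ij} : ℝ → ℂ (i,j ≥ 0) be differentiable functions with μ_{ij}(t) = -μ_{ji}(t), satisfying μ_{ij}'(t) = μ_{i+1,j}(t) + μ_{i,j+1}(t). For n ≥ 0 and z ∈ ℂ define P_{2n}(t,z) = Σ_{k=0}^{2n} (-z)^k pf(0,…,k̂,…,2n) and P_{2n+1}(t,z) = z^{2n+1} τ_{2n}(t) + Σ_{k=0}^{2n-1} (-z)^k pf(0,…,k̂,…,2n-1,2n+1), the Pfaffians being computed from μ(t) and τ_{2n}(t) = pf(0,…,2n-1). Then for every t and every z ∈ ℂ: ∂/∂t P_{2n}(t,z) + z · P_{2n}(t,z)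 = P_{2n+1}(t,z). -/
open Matrix

/-- `P_{2n}(t,z) = Σ_{k=0}^{2n} (-z)^k pf(0,…,k̂,…,2n)`, Pfaffians computed from `μ(t)`. -/
noncomputable def Peven (μ : ℕ → ℕ → ℝ → ℂ) (n : ℕ) (t : ℝ) (z : ℂ) : ℂ :=
  ∑ k ∈ Finset.range (2 * n + 1),
    (-z) ^ k *
      pfv n (fun i j => μ i j t) (fun a => if a.val < k then a.val else a.val + 1)

/-- `P_{2n+1}(t,z) = z^{2n+1} τ_{2n}(t) + Σ_{k=0}^{2n-1} (-z)^k pf(0,…,k̂,…,2n-1,2n+1)`,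
Pfaffians computed from `μ(t)`, with `τ_{2n}(t) = pf(0,…,2n-1)`. -/
noncomputable def Podd (μ : ℕ → ℕ → ℝ → ℂ) (n : ℕ) (t : ℝ) (z : ℂ) : ℂ :=
  z ^ (2 * n + 1) * pfv n (fun i j => μ i j t) (fun a => a.val) +
    ∑ k ∈ Finset.range (2 * n),
      (-z) ^ k *
        pfv n (fun i j => μ i j t) (fun a =>
          if a.val < k then a.val
          else if a.val < 2 * n - 1 then a.val + 1
          else 2 * n + 1)

theorem aux_sum_pairs (m : ℕ) (F : Fin (2 * m) → ℂ) :
    ∑ b, F b = ∑ p : Fin m, (F ⟨2 * p.val, by have := p.isLt; omega⟩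
      + F ⟨2 * p.val + 1, by have := p.isLt; omega⟩) := by
  induction m with
  | zero => simp
  | succ m ih =>
    rw [Fin.sum_univ_castSucc (n := m)]
    have h := ih (fun b => F ⟨b.val, by have := b.isLt; omega⟩)
    simp only [Fin.val_castSucc, Fin.val_last]
    rw [← h]
    change ∑ b : Fin (2 * m + 1 + 1), F b = _
    rw [Fin.sum_univ_castSucc, Fin.sum_univ_castSucc]
    rw [add_assoc]
    rfl

/-- raise index `a` -/
def bump {N : ℕ} (v : Fin N → ℕ) (a : Fin N) : Fin N → ℕ :=
  fun b => if b = a then v b + 1 else v b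

theorem aux_pfv_zero (m : ℕ) (μ : ℕ → ℕ → ℂ) (v : Fin (2 * m) → ℕ) (a b : Fin (2 * m))
    (hab : a ≠ b) (h : v a = v b) : pfv m μ v = 0 := by
  have hv : ∀ x, v (Equiv.swap a b x) = v x := by
    intro x
    by_cases h1 : x = a
    · subst h1; simp [h]
    by_cases h2 : x = b
    · subst h2; simp [h]
    rw [Equiv.swap_apply_of_ne_of_ne h1 h2]
  unfold pfv pf
  apply mul_eq_zero_of_right
  set S := ∑ σ : Equiv.Perm (Fin (2 * m)), ((Equiv.Perm.sign σ : ℤ) : ℂ) *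
        ∏ p : Fin m,
          (Matrix.of fun a b => μ (v a) (v b)) (σ ⟨2 * p.val, by have := p.isLt; omega⟩)
            (σ ⟨2 * p.val + 1, by have := p.isLt; omega⟩) with hS
  have : S = -S := by
    conv_lhs => rw [hS, ← Equiv.sum_comp (Equiv.mulLeft (Equiv.swap a b))]
    rw [hS, ← Finset.sum_neg_distrib]
    refine Finset.sum_congr rfl fun σ _ => ?_
    simp [hv, Equiv.Perm.sign_mul, Equiv.Perm.sign_swap hab]
  exact self_eq_neg.mp this

theorem aux_prod_deriv (μ : ℕ → ℕ → ℝ → ℂ)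
    (hderiv : ∀ i j t, HasDerivAt (μ i j) (μ (i + 1) j t + μ i (j + 1) t) t)
    (m : ℕ) (v : Fin (2 * m) → ℕ) (t : ℝ) :
    HasDerivAt (fun s => ∏ p : Fin m, μ (v ⟨2 * p.val, by have := p.isLt; omega⟩)
      (v ⟨2 * p.val + 1, by have := p.isLt; omega⟩) s)
      (∑ a, ∏ p : Fin m, μ (bump v a ⟨2 * p.val, by have := p.isLt; omega⟩)
      (bump v a ⟨2 * p.val + 1, by have := p.isLt; omega⟩) t) t := by
  have h := HasDerivAt.fun_finsetProd (u := Finset.univ) (x := t) (fun (p : Fin m) _ =>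
    hderiv (v ⟨2 * p.val, by have := p.isLt; omega⟩)
      (v ⟨2 * p.val + 1, by have := p.isLt; omega⟩) t)
  refine h.congr_deriv ?_
  rw [aux_sum_pairs]
  refine Finset.sum_congr rfl fun p _ => ?_
  rw [smul_eq_mul, mul_add]
  have key : ∀ q ∈ Finset.univ.erase p, q.val ≠ p.val := by
    intro q hq h
    exact (Finset.mem_erase.mp hq).1 (Fin.ext h)
  congr 1
  · rw [← Finset.prod_erase_mul _ _ (Finset.mem_univ p)]
    congr 1
    · refine Finset.prod_congr rfl fun q hq => ?_
      have := key q hq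
      have h1 : ¬ (2 * q.val = 2 * p.val) := by omega
      have h2 : ¬ (2 * q.val + 1 = 2 * p.val) := by omega
      simp only [bump, Fin.mk.injEq, h1, h2, if_false]
    · simp [bump]
  · rw [← Finset.prod_erase_mul _ _ (Finset.mem_univ p)]
    congr 1
    · refine Finset.prod_congr rfl fun q hq => ?_
      have := key q hq
      have h1 : ¬ (2 * q.val = 2 * p.val + 1) := by omega
      have h2 : ¬ (2 * q.val + 1 = 2 * p.val + 1) := by omega
      simp only [bump, Fin.mk.injEq, h1, h2, if_false]
    · simp [bump]

theorem aux_pfv_deriv (μ : ℕ → ℕ → ℝ → ℂ)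
    (hderiv : ∀ i j t, HasDerivAt (μ i j) (μ (i + 1) j t + μ i (j + 1) t) t)
    (m : ℕ) (v : Fin (2 * m) → ℕ) (t : ℝ) :
    HasDerivAt (fun s => pfv m (fun i j => μ i j s) v)
      (∑ a, pfv m (fun i j => μ i j t) (bump v a)) t := by
  unfold pfv pf
  rw [← Finset.mul_sum, Finset.sum_comm]
  refine HasDerivAt.const_mul _ ?_
  refine HasDerivAt.fun_sum fun σ _ => ?_
  rw [← Finset.mul_sum]
  refine HasDerivAt.const_mul _ ?_
  refine (aux_prod_deriv μ hderiv m (fun b => v (σ b)) t).congr_deriv ?_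
  refine Fintype.sum_equiv σ _ _ fun a => ?_
  refine Finset.prod_congr rfl fun p _ => ?_
  simp [bump]

theorem aux_sum_bump (μ : ℕ → ℕ → ℂ) (n k : ℕ) (hk : k ≤ 2 * n) :
    ∑ a, pfv n μ (bump (fun a => if a.val < k then a.val else a.val + 1) a) =
      (if 1 ≤ k then pfv n μ (fun a => if a.val < k - 1 then a.val else a.val + 1) else 0) +
      (if k < 2 * n then pfv n μ (fun a =>
          if a.val < k then a.val
          else if a.val < 2 * n - 1 then a.val + 1
          else 2 * n + 1) else 0) := by
  set V := pfv n μ (fun a => if a.val < k - 1 then a.val else a.val + 1)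
  set W := pfv n μ (fun a =>
          if a.val < k then a.val
          else if a.val < 2 * n - 1 then a.val + 1
          else 2 * n + 1)
  have h : ∀ a : Fin (2 * n),
      pfv n μ (bump (fun a => if a.val < k then a.val else a.val + 1) a) =
      (if a.val + 1 = k then V else 0) + (if a.val + 1 = 2 * n ∧ k < 2 * n then W else 0) := by
    intro a
    have ha := a.isLt
    by_cases h1 : a.val + 1 = k
    · rw [if_pos h1, if_neg (by omega), add_zero]
      congr 1
      funext b
      simp only [bump, Fin.ext_iff]
      split_ifs <;> omega
    · by_cases h2 : a.val + 1 = 2 * n ∧ k < 2 * n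
      · rw [if_neg h1, if_pos h2, zero_add]
        congr 1
        funext b
        have := b.isLt
        simp only [bump, Fin.ext_iff]
        split_ifs <;> omega
      · rw [if_neg h1, if_neg h2, zero_add]
        have h3 : a.val + 1 < 2 * n := by omega
        refine aux_pfv_zero n μ _ a ⟨a.val + 1, h3⟩ ?_ ?_
        · simp [Fin.ext_iff]
        · simp only [bump, Fin.ext_iff]
          split_ifs <;> omega
  rw [Finset.sum_congr rfl fun a _ => h a, Finset.sum_add_distrib]
  congr 1
  · split_ifs with h1
    · rw [Finset.sum_eq_single (⟨k - 1, by omega⟩ : Fin (2 * n))]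
      · rw [if_pos (by simp; omega)]
      · intro b _ hb
        rw [if_neg]
        intro h; apply hb; ext; simp; omega
      · simp
    · exact Finset.sum_eq_zero fun a _ => if_neg (by omega)
  · split_ifs with h1
    · rw [Finset.sum_eq_single (⟨2 * n - 1, by omega⟩ : Fin (2 * n))]
      · rw [if_pos (by simp; omega)]
      · intro b _ hb
        rw [if_neg]
        intro h; apply hb; ext; simp; omega
      · simp
    · exact Finset.sum_eq_zero fun a _ => if_neg (by omega)

theorem deriv_Peven_eq_Podd (μ : ℕ → ℕ → ℝ → ℂ)
    (hskew : ∀ i j t, μ i j t = -μ j i t)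
    (hderiv : ∀ i j t, HasDerivAt (μ i j) (μ (i + 1) j t + μ i (j + 1) t) t)
    (n : ℕ) (t : ℝ) (z : ℂ) :
    HasDerivAt (fun s => Peven μ n s z) (Podd μ n t z - z * Peven μ n t z) t := by
  have h := HasDerivAt.fun_sum (u := Finset.range (2 * n + 1)) (x := t) (fun k _ =>
    (aux_pfv_deriv μ hderiv n (fun a => if a.val < k then a.val else a.val + 1) t).const_mul
      ((-z) ^ k))
  refine h.congr_deriv ?_
  rw [Finset.sum_congr rfl fun k hk => by
    rw [aux_sum_bump _ n k (by have := Finset.mem_range.mp hk; omega), mul_add]]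
  rw [Finset.sum_add_distrib, Finset.sum_range_succ', Finset.sum_range_succ _ (2 * n)]
  unfold Podd Peven
  rw [Finset.sum_range_succ _ (2 * n)]
  have e1 : pfv n (fun i j => μ i j t) (fun a => if a.val < 2 * n then a.val else a.val + 1)
      = pfv n (fun i j => μ i j t) (fun a => a.val) := by
    congr 1
    funext a
    simp
  rw [e1]
  rw [Finset.sum_congr rfl fun k hk => by
    rw [if_pos (by omega), Nat.add_sub_cancel, pow_succ, mul_comm ((-z) ^ k) (-z), mul_assoc]]
  rw [← Finset.mul_sum]
  have e3 : ∀ f : ℕ → ℂ, ∑ k ∈ Finset.range (2 * n), (-z) ^ k * (if k < 2 * n then f k else 0)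
      = ∑ k ∈ Finset.range (2 * n), (-z) ^ k * f k := fun f =>
    Finset.sum_congr rfl fun k hk => by rw [if_pos (Finset.mem_range.mp hk)]
  rw [e3]
  have e2 : (-z) ^ (2 * n) = z ^ (2 * n) := by rw [pow_mul, pow_mul, neg_sq]
  rw [e2]
  simp only [lt_irrefl, if_false]
  simp
  ring
end

section
/- Let m be an invertible skew-symmetric 2N×2N complex matrix. Suppose Q and Q̃ are invertible 2N×2N matrices, both belonging to 𝕜 (block lower triangular with each diagonal 2×2 block a scalar multiple of the 2×2 identity), such that Q m Qᵀ = J and Q̃ m Q̃ᵀ = J. Then there exist signs ε₀, …, ε_{N-1} ∈ {1,-1} such that Q̃ = E·Q, where E is the block-diagonal matrix whose n-th diagonal 2×2 block is ε_n·I₂; that is, the skew-Borel decomposition m = Q⁻¹ J (Q⁻¹)ᵀ with Q ∈ 𝕜 is unique modulo such signs. -/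
open Matrix

lemma lowQ {N : ℕ} {Q : Matrix (Fin (2 * N)) (Fin (2 * N)) ℂ} (hQ : memK N Q) :
    BlockTriangular Q (fun i : Fin (2 * N) => OrderDual.toDual (i.val / 2)) := by
  intro i j hij
  have h := congrFun (congrFun hQ.1 i) j
  have hij' : i.val / 2 < j.val / 2 := hij
  simpa [bUp, hij'] using h

lemma offQ {N : ℕ} {Q : Matrix (Fin (2 * N)) (Fin (2 * N)) ℂ} (hQ : memK N Q)
    (i j : Fin (2 * N)) (h : i.val / 2 = j.val / 2) (hij : i ≠ j) : Q i j = 0 := by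
  have := hQ.2.1 i j hij
  simpa [bDiag, h] using this

lemma diagQ {N : ℕ} {Q : Matrix (Fin (2 * N)) (Fin (2 * N)) ℂ} (hQ : memK N Q)
    (i j : Fin (2 * N)) (h : i.val / 2 = j.val / 2) : Q i i = Q j j := by
  have := hQ.2.2 i j h
  simpa [bDiag] using this

lemma diagQ_ne {N : ℕ} {Q : Matrix (Fin (2 * N)) (Fin (2 * N)) ℂ} (hQ : memK N Q)
    (hu : IsUnit Q) (i : Fin (2 * N)) : Q i i ≠ 0 := by
  have ht : BlockTriangular Q OrderDual.toDual := by
    intro a b hab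
    have hab' : a < b := hab
    by_cases h : a.val / 2 = b.val / 2
    · exact offQ hQ a b h hab'.ne
    · apply lowQ hQ
      change a.val / 2 < b.val / 2
      have : a.val < b.val := hab'
      omega
  have hd := det_of_lowerTriangular Q ht
  have hu' := (Matrix.isUnit_iff_isUnit_det Q).1 hu
  rw [hd] at hu'
  exact Finset.prod_ne_zero_iff.1 hu'.ne_zero i (Finset.mem_univ i)

lemma invTri {n : ℕ} {α : Type} [LinearOrder α] {M : Matrix (Fin n) (Fin n) ℂ} {b : Fin n → α}
    (hu : IsUnit M) (h : BlockTriangular M b) : BlockTriangular M⁻¹ b := by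
  haveI := hu.invertible
  exact blockTriangular_inv_of_blockTriangular h

theorem skew_borel_decomposition_unique_mod_signs (N : ℕ) (hN : 1 ≤ N)
    (m Q Q' : Matrix (Fin (2 * N)) (Fin (2 * N)) ℂ)
    (hm_skew : mᵀ = -m) (hm_inv : IsUnit m)
    (hQ : memK N Q) (hQ' : memK N Q')
    (hQu : IsUnit Q) (hQ'u : IsUnit Q')
    (hQm : Q * m * Qᵀ = Jmat N) (hQ'm : Q' * m * Q'ᵀ = Jmat N) :
    ∃ ε : Fin N → ℂ, (∀ p : Fin N, ε p = 1 ∨ ε p = -1) ∧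
      Q' = (Matrix.of fun i j : Fin (2 * N) =>
              if i = j then ε ⟨i.val / 2, by have := i.isLt; omega⟩ else 0) * Q := by
  have hJu : IsUnit (Jmat N) := by
    rw [← hQm]
    exact (hQu.mul hm_inv).mul ((Matrix.isUnit_transpose Q).2 hQu)
  have hQd := (Matrix.isUnit_iff_isUnit_det Q).1 hQu
  have hQ'd := (Matrix.isUnit_iff_isUnit_det Q').1 hQ'u
  have hJd := (Matrix.isUnit_iff_isUnit_det _).1 hJu
  obtain ⟨R, hR⟩ : ∃ R, R = Q' * Q⁻¹ := ⟨_, rfl⟩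
  obtain ⟨S, hS⟩ : ∃ S, S = Q * Q'⁻¹ := ⟨_, rfl⟩
  have hRQ : R * Q = Q' := by rw [hR, Matrix.mul_assoc, nonsing_inv_mul _ hQd, Matrix.mul_one]
  have hSQ : S * Q' = Q := by rw [hS, Matrix.mul_assoc, nonsing_inv_mul _ hQ'd, Matrix.mul_one]
  have hSR : S * R = 1 := by
    rw [hR, ← Matrix.mul_assoc, hSQ, mul_nonsing_inv _ hQd]
  have hRJ : R * Jmat N * Rᵀ = Jmat N := by
    have h := hQ'm
    rw [← hRQ, transpose_mul] at h
    calc R * Jmat N * Rᵀ = R * (Q * m * Qᵀ) * Rᵀ := by rw [hQm]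
      _ = R * Q * m * (Qᵀ * Rᵀ) := by simp only [Matrix.mul_assoc]
      _ = _ := h
  have hRS : Rᵀ * Sᵀ = 1 := by rw [← transpose_mul, hSR, transpose_one]
  have hRJS : R * Jmat N = Jmat N * Sᵀ := by
    calc R * Jmat N = R * Jmat N * (Rᵀ * Sᵀ) := by rw [hRS, Matrix.mul_one]
      _ = R * Jmat N * Rᵀ * Sᵀ := by simp only [Matrix.mul_assoc]
      _ = _ := by rw [hRJ]
  have hReq : R = Jmat N * Sᵀ * (Jmat N)⁻¹ := by
    rw [← hRJS, Matrix.mul_assoc, mul_nonsing_inv _ hJd, Matrix.mul_one]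
  have hRlow : BlockTriangular R (fun i : Fin (2 * N) => OrderDual.toDual (i.val / 2)) := by
    rw [hR]; exact (lowQ hQ').mul (invTri hQu (lowQ hQ))
  have hSlow : BlockTriangular S (fun i : Fin (2 * N) => OrderDual.toDual (i.val / 2)) := by
    rw [hS]; exact (lowQ hQ).mul (invTri hQ'u (lowQ hQ'))
  have hSup : BlockTriangular Sᵀ (fun i : Fin (2 * N) => i.val / 2) :=
    fun i j hij => hSlow hij
  have hJup : BlockTriangular (Jmat N) (fun i : Fin (2 * N) => i.val / 2) := by
    intro i j hij
    have hij' : j.val / 2 < i.val / 2 := hij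
    simp [Jmat, hij'.ne']
  have hRup : BlockTriangular R (fun i : Fin (2 * N) => i.val / 2) := by
    rw [hReq]; exact (hJup.mul hSup).mul (invTri hJu hJup)
  have hRblk : ∀ i j : Fin (2 * N), i.val / 2 ≠ j.val / 2 → R i j = 0 := by
    intro i j h
    rcases lt_or_gt_of_ne h with h | h
    · exact hRlow h
    · exact hRup h
  have hent : ∀ i j : Fin (2 * N), i.val / 2 = j.val / 2 → R i j * Q j j = Q' i j := by
    intro i j h
    rw [← hRQ, Matrix.mul_apply, Finset.sum_eq_single j]
    · intro k _ hk
      by_cases hb : i.val / 2 = k.val / 2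
      · rw [offQ hQ k j (hb.symm.trans h) hk, mul_zero]
      · rw [hRblk i k hb, zero_mul]
    · simp
  have hoff : ∀ i j : Fin (2 * N), i ≠ j → R i j = 0 := by
    intro i j hij
    by_cases hb : i.val / 2 = j.val / 2
    · have h := hent i j hb
      rw [offQ hQ' i j hb hij] at h
      exact (mul_eq_zero.1 h).resolve_right (diagQ_ne hQ hQu j)
    · exact hRblk i j hb
  have hdiag : ∀ i j : Fin (2 * N), i.val / 2 = j.val / 2 → R i i = R j j := by
    intro i j h
    have h1 := hent i i rfl
    have h2 := hent j j rfl
    rw [diagQ hQ i j h, diagQ hQ' i j h, ← h2] at h1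
    exact mul_right_cancel₀ (diagQ_ne hQ hQu j) h1
  have hRd : R = Matrix.diagonal (fun i => R i i) := by
    ext i j
    by_cases h : i = j
    · subst h; simp
    · simp [h, hoff i j h]
  refine ⟨fun p => R ⟨2 * p.val, by have := p.isLt; omega⟩ ⟨2 * p.val, by have := p.isLt; omega⟩,
    ?_, ?_⟩
  · intro p
    have hp := p.isLt
    have h := congrFun (congrFun hRJ ⟨2 * p.val, by omega⟩) ⟨2 * p.val + 1, by omega⟩
    rw [hRd, diagonal_transpose, Matrix.mul_diagonal, Matrix.diagonal_mul] at h
    rw [← hdiag ⟨2 * p.val, by omega⟩ ⟨2 * p.val + 1, by omega⟩ (by simp only; omega)] at h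
    have hJ1 : Jmat N ⟨2 * p.val, by omega⟩ ⟨2 * p.val + 1, by omega⟩ = 1 := by
      have h1 : (2 * p.val) / 2 = (2 * p.val + 1) / 2 := by omega
      have h2 : (2 * p.val) % 2 = 0 := by omega
      have h3 : (2 * p.val + 1) % 2 = 1 := by omega
      simp only [Jmat, Matrix.of_apply, h1, h2, h3]
      simp
    rw [hJ1, mul_one] at h
    exact mul_self_eq_one_iff.1 h
  · rw [← hRQ]
    congr 1
    ext i j
    by_cases h : i = j
    · subst h
      simp only [Matrix.of_apply, if_true]
      exact hdiag _ _ (by simp only; omega)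
    · simp [h, hoff i j h]
end
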